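/- Let G, Ḡ ∈ F[z]^{k×n} be basic reduced matrices of degree δ that are strongly isometric (wt(uG) = wt(uḠ) for all u ∈ F[z]^k and deg(uG) = deg(uḠ) for all nonzero u ∈ F[z]^k) and suppose Λ(G)_{X,Y} = Λ(Ḡ)_{X,Y} for all X, Y ∈ F^δ, i.e. for all X, Y ∈ F^δ and every w ∈ ℕ₀ the number of u ∈ F^k with Y = XA + uB and wt(XC + uD) = w equals the number of u ∈ F^k with Y = XĀ + uB̄ and wt(XC̄ + uD̄) = w, where (A,B,C,D) and (Ā,B̄,C̄,D̄) are the CCFs of G and Ḡ. Then G and Ḡ are monomially equivalent. -/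

import Mathlib

open Matrix Polynomial

variable {F : Type*} [Field F]

/-- The weight of a polynomial row vector: the total number of nonzero
coefficients occurring in its entries. -/
def wtP {n : ℕ} (v : Fin n → Polynomial F) : ℕ := ∑ i, (v i).support.card

/-- The degree of a polynomial row vector: the maximal degree of its entries. -/
def degP {n : ℕ} (v : Fin n → Polynomial F) : ℕ := Finset.univ.sup fun i => (v i).natDegree

/-- A polynomial matrix is basic if its evaluation at every point of the algebraic
closure has full row rank. -/
def IsBasic {k n : ℕ} (G : Matrix (Fin k) (Fin n) (Polynomial F)) : Prop :=
  ∀ lam : AlgebraicClosure F, (G.map fun p => (Polynomial.aeval lam) p).rank = k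

/-- A monomial matrix over `F`: permutation times invertible diagonal. -/
def IsMonomialMatrix {n : ℕ} (M : Matrix (Fin n) (Fin n) F) : Prop :=
  ∃ (σ : Equiv.Perm (Fin n)) (d : Fin n → Fˣ),
    ∀ i j, M i j = if σ i = j then (d j : F) else 0

/-- The `i`-th row degree of a polynomial matrix. -/
def rowDeg {k n : ℕ} (G : Matrix (Fin k) (Fin n) (Polynomial F)) (i : Fin k) : ℕ :=
  Finset.univ.sup fun j => (G i j).natDegree

/-- The (internal) degree of a polynomial matrix: the maximal degree of its `k × k` minors. -/
noncomputable def degMat {k n : ℕ} (G : Matrix (Fin k) (Fin n) (Polynomial F)) : ℕ :=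
  Finset.univ.sup fun f : Fin k ↪ Fin n => (Matrix.det fun i i' => G i (f i')).natDegree

/-- A polynomial matrix is reduced if the sum of its row degrees equals its degree. -/
noncomputable def IsRowReduced {k n : ℕ} (G : Matrix (Fin k) (Fin n) (Polynomial F)) : Prop :=
  (∑ i, rowDeg G i) = degMat G

/-- Index set for the state space of the controller canonical form with row degrees `ν`. -/
abbrev StateIdx {k : ℕ} (ν : Fin k → ℕ) := (i : Fin k) × Fin (ν i)

/-- The matrix `A` of the controller canonical form. -/
def ccfA {k : ℕ} (ν : Fin k → ℕ) : Matrix (StateIdx ν) (StateIdx ν) F :=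
  fun p q => if p.1 = q.1 ∧ (q.2 : ℕ) = (p.2 : ℕ) + 1 then 1 else 0

/-- The matrix `B` of the controller canonical form. -/
def ccfB {k : ℕ} (ν : Fin k → ℕ) : Matrix (Fin k) (StateIdx ν) F :=
  fun i q => if i = q.1 ∧ (q.2 : ℕ) = 0 then 1 else 0

/-- The matrix `C` of the controller canonical form of `G`. -/
def ccfC {k n : ℕ} (G : Matrix (Fin k) (Fin n) (Polynomial F)) :
    Matrix (StateIdx (rowDeg G)) (Fin n) F :=
  fun p j => (G p.1 j).coeff ((p.2 : ℕ) + 1)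

/-- The matrix `D` of the controller canonical form of `G`. -/
def ccfD {k n : ℕ} (G : Matrix (Fin k) (Fin n) (Polynomial F)) :
    Matrix (Fin k) (Fin n) F :=
  fun i j => (G i j).coeff 0

/-- The entry of the weight adjacency matrix of `G` at the pair of states `(X, Y)`:
the coefficient of `W^w` is the number of inputs `u` realizing the state transition
`X → Y` whose corresponding output has Hamming weight `w`. -/
noncomputable def WAMe {k n : ℕ} [DecidableEq F] (G : Matrix (Fin k) (Fin n) (Polynomial F))
    (X Y : StateIdx (rowDeg G) → F) (w : ℕ) : ℕ :=
  Set.ncard {u : Fin k → F |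
    X ᵥ* ccfA (rowDeg G) + u ᵥ* ccfB (rowDeg G) = Y ∧
    hammingNorm (X ᵥ* ccfC G + u ᵥ* ccfD G) = w}

/-- The canonical enumeration of the state indices. -/
def encIdx {k : ℕ} (ν : Fin k → ℕ) (p : StateIdx ν) : ℕ :=
  (∑ i' ∈ Finset.univ.filter (fun i' => i' < p.1), ν i') + (p.2 : ℕ)

theorem encIdx_lt {k : ℕ} (ν : Fin k → ℕ) (p : StateIdx ν) : encIdx ν p < ∑ i, ν i := by
  have h1 : (p.2 : ℕ) < ν p.1 := p.2.isLt
  have h2 : ν p.1 ≤ ∑ i' ∈ Finset.univ.filter (fun i' => ¬ i' < p.1), ν i' :=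
    Finset.single_le_sum (fun i _ => Nat.zero_le _) (by simp)
  have h3 := Finset.sum_filter_add_sum_filter_not Finset.univ (fun i' => i' < p.1) ν
  unfold encIdx
  omega

/-- The canonical identification of the state space with `Fin δ`. -/
def stateEnc {k : ℕ} (ν : Fin k → ℕ) {δ : ℕ} (h : (∑ i, ν i) = δ) (p : StateIdx ν) : Fin δ :=
  ⟨encIdx ν p, h ▸ encIdx_lt ν p⟩

/-- The entry of the weight adjacency matrix of `G` at states `X, Y ∈ F^δ`, using the
canonical identification of the state space of the controller canonical form with `F^δ`. -/
noncomputable def WAMfin {k n δ : ℕ} [DecidableEq F] (G : Matrix (Fin k) (Fin n) (Polynomial F))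
    (h : (∑ i, rowDeg G i) = δ) (X Y : Fin δ → F) (w : ℕ) : ℕ :=
  WAMe G (fun p => X (stateEnc (rowDeg G) h p)) (fun p => Y (stateEnc (rowDeg G) h p)) w


section CodingLemmas

theorem card_support_eq_erase_add {F : Type*} [Field F] [DecidableEq F] (q : Polynomial F)
    (N : ℕ) : q.support.card = (q.support.erase N).card + if q.coeff N ≠ 0 then 1 else 0 := by
  by_cases h : q.coeff N = 0
  · rw [Finset.erase_eq_of_notMem (by simpa using h)]
    simp [h]
  · rw [if_pos h, Finset.card_erase_add_one (by simpa using h)]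

theorem wtP_eq_add_hammingNorm {F : Type*} [Field F] [DecidableEq F] {n : ℕ}
    (v : Fin n → Polynomial F) (N : ℕ) :
    wtP v = ∑ j, ((v j).support.erase N).card + hammingNorm (fun j => (v j).coeff N) := by
  rw [wtP, Finset.sum_congr rfl fun j _ => card_support_eq_erase_add (v j) N,
    Finset.sum_add_distrib, hammingNorm, Finset.card_filter]

/-- Adding terms of degree `N` changes the weight only through the coefficients at `N`. -/
theorem wtP_add_monomial {F : Type*} [Field F] [DecidableEq F] {n : ℕ}
    (v : Fin n → Polynomial F) (c : Fin n → F) (N : ℕ) :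
    wtP (fun j => v j + monomial N (c j)) + hammingNorm (fun j => (v j).coeff N)
      = wtP v + hammingNorm (fun j => (v j).coeff N + c j) := by
  have h : ∀ j, (v j + monomial N (c j)).support.erase N = (v j).support.erase N := by
    intro j
    ext m
    simp only [Finset.mem_erase, mem_support_iff, coeff_add, coeff_monomial]
    refine and_congr_right fun hm => ?_
    rw [if_neg (Ne.symm hm), add_zero]
  rw [wtP_eq_add_hammingNorm _ N, wtP_eq_add_hammingNorm v N]
  simp only [h, coeff_add, coeff_monomial, if_true]
  omega

theorem encIdx_lt_encIdx {k : ℕ} (ν : Fin k → ℕ) {p q : StateIdx ν} (h : p.1 < q.1) :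
    encIdx ν p < encIdx ν q := by
  have h1 : (p.2 : ℕ) < ν p.1 := p.2.isLt
  have h2 : ∑ i' ∈ insert p.1 (Finset.univ.filter fun i' => i' < p.1), ν i' ≤
      ∑ i' ∈ Finset.univ.filter (fun i' => i' < q.1), ν i' := by
    refine Finset.sum_le_sum_of_subset fun i hi => ?_
    simp only [Finset.mem_insert, Finset.mem_filter, Finset.mem_univ, true_and] at hi ⊢
    rcases hi with rfl | hi
    · exact h
    · exact hi.trans h
  rw [Finset.sum_insert (by simp)] at h2
  unfold encIdx
  omega

theorem stateEnc_injective {k : ℕ} (ν : Fin k → ℕ) {δ : ℕ} (h : (∑ i, ν i) = δ) :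
    Function.Injective (stateEnc ν h) := by
  rintro ⟨i, a⟩ ⟨i', a'⟩ hpq
  have he : encIdx ν ⟨i, a⟩ = encIdx ν ⟨i', a'⟩ := congrArg Fin.val hpq
  rcases lt_trichotomy i i' with hlt | rfl | hlt
  · exact absurd he (encIdx_lt_encIdx ν (p := ⟨i, a⟩) (q := ⟨i', a'⟩) hlt).ne
  · have : a = a' := Fin.ext (by simpa [encIdx] using he)
    rw [this]
  · exact absurd he (encIdx_lt_encIdx ν (p := ⟨i', a'⟩) (q := ⟨i, a⟩) hlt).ne'

/-- The `j`-th output symbol at state `X` and input `u`, as a linear functional of `(X, u)`. -/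
def outputFunctional {F : Type*} [Field F] {k n : ℕ} (ν : Fin k → ℕ)
    (H : Matrix (Fin k) (Fin n) (Polynomial F)) (j : Fin n) :
    Module.Dual F ((StateIdx ν → F) × (Fin k → F)) where
  toFun x := ∑ p, x.1 p * (H p.1 j).coeff ((p.2 : ℕ) + 1) + ∑ i, x.2 i * (H i j).coeff 0
  map_add' x y := by
    simp only [Prod.fst_add, Prod.snd_add, Pi.add_apply, add_mul, Finset.sum_add_distrib]
    ring
  map_smul' c x := by
    simp only [Prod.smul_fst, Prod.smul_snd, Pi.smul_apply, smul_eq_mul, RingHom.id_apply,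
      mul_add, Finset.mul_sum, mul_assoc]

theorem outputFunctional_apply {F : Type*} [Field F] {k n : ℕ} (ν : Fin k → ℕ)
    (H : Matrix (Fin k) (Fin n) (Polynomial F)) (j : Fin n) (X : StateIdx ν → F)
    (u : Fin k → F) : outputFunctional ν H j (X, u) =
      ∑ p, X p * (H p.1 j).coeff ((p.2 : ℕ) + 1) + ∑ i, u i * (H i j).coeff 0 := rfl

theorem WAMfin_eq_ncard {F : Type*} [Field F] [DecidableEq F] {k n δ : ℕ}
    (H : Matrix (Fin k) (Fin n) (Polynomial F)) (h : (∑ i, rowDeg H i) = δ) (ν : Fin k → ℕ)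
    (hν : (∑ i, ν i) = δ) (hH : rowDeg H = ν) (X Y : Fin δ → F) (w : ℕ) :
    WAMfin H h X Y w = Set.ncard {u : Fin k → F |
      (fun p => X (stateEnc ν hν p)) ᵥ* ccfA ν + u ᵥ* ccfB ν = (fun p => Y (stateEnc ν hν p)) ∧
      hammingNorm (fun j => outputFunctional ν H j (fun p => X (stateEnc ν hν p), u)) = w} := by
  subst hH
  rfl

/-- An input polynomial vector driving the encoder to state `X` and input `u` at time `N`. -/
noncomputable def reachInput {F : Type*} [Field F] {k : ℕ} (ν : Fin k → ℕ) (N : ℕ)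
    (X : StateIdx ν → F) (u : Fin k → F) (i : Fin k) : Polynomial F :=
  monomial N (u i) + ∑ l : Fin (ν i), monomial (N - 1 - (l : ℕ)) (X ⟨i, l⟩)

theorem coeff_monomial_mul_of_le {F : Type*} [Field F] (h : Polynomial F) (a : F) {m N : ℕ}
    (hm : m ≤ N) : (monomial m a * h).coeff N = a * h.coeff (N - m) := by
  rw [← C_mul_X_pow_eq_monomial, mul_assoc, coeff_C_mul, coeff_X_pow_mul', if_pos hm]

theorem coeff_reachInput_vecMul {F : Type*} [Field F] {k n : ℕ} (ν : Fin k → ℕ) {N : ℕ}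
    (hN : ∀ i, ν i ≤ N) (H : Matrix (Fin k) (Fin n) (Polynomial F)) (X : StateIdx ν → F)
    (u : Fin k → F) (j : Fin n) :
    ((reachInput ν N X u ᵥ* H) j).coeff N = outputFunctional ν H j (X, u) := by
  rw [outputFunctional_apply, Fintype.sum_sigma, ← Finset.sum_add_distrib]
  simp only [vecMul, dotProduct, finsetSum_coeff]
  refine Finset.sum_congr rfl fun i _ => ?_
  rw [reachInput, add_mul, coeff_add, coeff_monomial_mul_of_le _ _ le_rfl, Finset.sum_mul,
    finsetSum_coeff, Nat.sub_self, add_comm]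
  congr 1
  refine Finset.sum_congr rfl fun l _ => ?_
  have h1 := l.isLt
  have h2 := hN i
  rw [coeff_monomial_mul_of_le _ _ (by omega), show N - (N - 1 - (l : ℕ)) = l + 1 by omega]

theorem wtP_reachInput_add {F : Type*} [Field F] [DecidableEq F] {k n : ℕ} (ν : Fin k → ℕ)
    {N : ℕ} (hN : ∀ i, ν i ≤ N) (H : Matrix (Fin k) (Fin n) (Polynomial F))
    (hH : ∀ i j, (H i j).natDegree ≤ ν i) (X : StateIdx ν → F) (u u' : Fin k → F)
    (huu' : ∀ i, ν i ≠ 0 → u' i = u i) :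
    wtP (reachInput ν N X u' ᵥ* H) + hammingNorm (fun j => outputFunctional ν H j (X, u)) =
      wtP (reachInput ν N X u ᵥ* H) + hammingNorm (fun j => outputFunctional ν H j (X, u')) := by
  have key : reachInput ν N X u' ᵥ* H = fun j => (reachInput ν N X u ᵥ* H) j +
      monomial N (∑ i, (u' i - u i) * (H i j).coeff 0) := by
    funext j
    simp only [vecMul, dotProduct, map_sum, ← Finset.sum_add_distrib]
    refine Finset.sum_congr rfl fun i _ => ?_
    by_cases hi : ν i = 0
    · obtain ⟨c, hc⟩ : ∃ c, H i j = C c :=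
        ⟨_, eq_C_of_natDegree_le_zero ((hH i j).trans hi.le)⟩
      rw [hc, coeff_C_zero, reachInput, reachInput, sub_mul, map_sub, ← monomial_mul_C,
        ← monomial_mul_C]
      ring
    · simp [reachInput, huu' i hi]
  have hc : (fun j => outputFunctional ν H j (X, u')) = fun j =>
      ((reachInput ν N X u ᵥ* H) j).coeff N + ∑ i, (u' i - u i) * (H i j).coeff 0 := by
    funext j
    rw [← coeff_reachInput_vecMul ν hN, key, coeff_add, coeff_monomial, if_pos rfl]
  rw [hc, ← funext fun j => coeff_reachInput_vecMul ν hN H X u j, key]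
  exact wtP_add_monomial _ _ N

theorem eq_of_vecMul_ccfB_eq {F : Type*} [Field F] {k : ℕ} (ν : Fin k → ℕ) {u u' : Fin k → F}
    (h : u' ᵥ* ccfB ν = u ᵥ* ccfB ν) (i : Fin k) (hi : ν i ≠ 0) : u' i = u i := by
  have := congrFun h ⟨i, ⟨0, Nat.pos_of_ne_zero hi⟩⟩
  simpa [vecMul, dotProduct, ccfB] using this

theorem sum_hammingNorm_eq_of_ncard_eq {F α : Type*} [Field F] [DecidableEq F] [Fintype α]
    {n : ℕ} (P : α → Prop) [DecidablePred P] (f g : α → Fin n → F)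
    (h : ∀ w, Set.ncard {a | P a ∧ hammingNorm (f a) = w} =
      Set.ncard {a | P a ∧ hammingNorm (g a) = w}) :
    ∑ a ∈ Finset.univ.filter P, hammingNorm (f a) =
      ∑ a ∈ Finset.univ.filter P, hammingNorm (g a) := by
  have key : ∀ e : α → Fin n → F, ∑ a ∈ Finset.univ.filter P, hammingNorm (e a) =
      ∑ w ∈ Finset.range (n + 1), Set.ncard {a | P a ∧ hammingNorm (e a) = w} * w := by
    intro e
    rw [← Finset.sum_fiberwise_of_maps_to (s := Finset.univ.filter P)
      (t := Finset.range (n + 1)) (g := fun a => hammingNorm (e a))]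
    · refine Finset.sum_congr rfl fun w _ => ?_
      rw [Finset.sum_congr rfl fun a ha => (Finset.mem_filter.1 ha).2, Finset.sum_const,
        smul_eq_mul, Finset.filter_filter, ← Set.ncard_coe_finset]
      simp
    · intro a _
      have := hammingNorm_le_card_fintype (x := e a)
      rw [Fintype.card_fin] at this
      exact Finset.mem_range.2 (Nat.lt_succ_of_le this)
  rw [key f, key g]
  exact Finset.sum_congr rfl fun w _ => by rw [h w]

theorem card_ker_of_ne_zero {F V : Type*} [Field F] [AddCommGroup V] [Module F V]
    {φ : Module.Dual F V} (hφ : φ ≠ 0) :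
    Nat.card V = Nat.card F * Nat.card (LinearMap.ker φ) := by
  rw [Submodule.card_eq_card_quotient_mul_card (LinearMap.ker φ), Nat.card_congr
    (φ.quotKerEquivOfSurjective (LinearMap.surjective_of_ne_zero hφ)).toEquiv, mul_comm]

open Classical in
theorem card_ker_inf_ker {F V : Type*} [Field F] [AddCommGroup V] [Module F V]
    (L φ : Module.Dual F V) :
    Nat.card F * Nat.card {x : LinearMap.ker L // φ x = 0} =
      Nat.card (LinearMap.ker L) * if φ ∈ Submodule.span F {L} then Nat.card F else 1 := by
  split_ifs with h
  · obtain ⟨c, rfl⟩ := Submodule.mem_span_singleton.1 h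
    rw [mul_comm]
    congr 1
    refine Nat.card_congr (Equiv.subtypeUnivEquiv fun x => ?_)
    have := x.2
    rw [LinearMap.mem_ker] at this
    simp [this]
  · have hne : φ.comp (LinearMap.ker L).subtype ≠ 0 := by
      intro h0
      apply h
      have hle : (⨅ i : Unit, LinearMap.ker ((fun _ => L) i)) ≤ LinearMap.ker φ := by
        intro x hx
        simp only [Submodule.mem_iInf] at hx
        exact LinearMap.congr_fun h0 ⟨x, hx ()⟩
      simpa using mem_span_of_iInf_ker_le_ker hle
    rw [mul_one, card_ker_of_ne_zero hne]
    rfl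

section MacWilliams

variable {F V : Type*} [Field F] [Finite F] [AddCommGroup V] [Module F V] [Finite V]

open Classical in
theorem card_span_mem_eq {n : ℕ} (f g : Fin n → Module.Dual F V)
    (h : ∀ x, (Finset.univ.filter fun i => f i x = 0).card =
      (Finset.univ.filter fun i => g i x = 0).card) (L : Module.Dual F V) :
    (Finset.univ.filter fun i => f i ∈ Submodule.span F {L}).card =
      (Finset.univ.filter fun i => g i ∈ Submodule.span F {L}).card := by
  have := Fintype.ofFinite V
  have hq : 1 < Nat.card F := Finite.one_lt_card
  have hK : 0 < Nat.card (LinearMap.ker L) := Nat.card_pos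
  have key : ∀ e : Fin n → Module.Dual F V,
      Nat.card F * ∑ x : LinearMap.ker L, (Finset.univ.filter fun i => e i x = 0).card =
        Nat.card (LinearMap.ker L) * (n +
        (Finset.univ.filter fun i => e i ∈ Submodule.span F {L}).card * (Nat.card F - 1)) := by
    intro e
    have h1 : ∑ x : LinearMap.ker L, (Finset.univ.filter fun i => e i x = 0).card =
        ∑ i, Nat.card {x : LinearMap.ker L // e i x = 0} := by
      simp only [Finset.card_filter, Nat.card_eq_fintype_card, Fintype.card_subtype]
      exact Finset.sum_comm
    rw [h1, Finset.mul_sum, Finset.sum_congr rfl fun i _ => card_ker_inf_ker L (e i),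
      ← Finset.mul_sum, Finset.card_filter, Finset.sum_mul]
    congr 1
    have h2 : ∀ i, (if e i ∈ Submodule.span F {L} then Nat.card F else 1) =
        1 + (if e i ∈ Submodule.span F {L} then 1 else 0) * (Nat.card F - 1) := by
      intro i
      split_ifs <;> omega
    rw [Finset.sum_congr rfl fun i _ => h2 i, Finset.sum_add_distrib]
    simp
  have h3 := key f
  simp only [h] at h3
  rw [key g] at h3
  have h4 := Nat.eq_of_mul_eq_mul_left hK h3.symm
  exact Nat.eq_of_mul_eq_mul_right (Nat.sub_pos_of_lt hq) (Nat.add_left_cancel h4)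

open Classical in
theorem card_span_eq_eq {n : ℕ} (f g : Fin n → Module.Dual F V)
    (h : ∀ x, (Finset.univ.filter fun i => f i x = 0).card =
      (Finset.univ.filter fun i => g i x = 0).card) (L : Module.Dual F V) :
    (Finset.univ.filter fun i => Submodule.span F {f i} = Submodule.span F {L}).card =
      (Finset.univ.filter fun i => Submodule.span F {g i} = Submodule.span F {L}).card := by
  have h0 := card_span_mem_eq f g h 0
  have hL := card_span_mem_eq f g h L
  by_cases hL0 : L = 0
  · subst hL0
    simpa [Submodule.span_zero_singleton, Submodule.span_singleton_eq_bot] using h0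
  · have key : ∀ e : Fin n → Module.Dual F V,
        (Finset.univ.filter fun i => e i ∈ Submodule.span F {L}).card =
        (Finset.univ.filter fun i => e i ∈ Submodule.span F {(0 : Module.Dual F V)}).card +
        (Finset.univ.filter fun i => Submodule.span F {e i} = Submodule.span F {L}).card := by
      intro e
      rw [← Finset.card_union_of_disjoint]
      · congr 1
        ext i
        simp only [Finset.mem_union, Finset.mem_filter, Finset.mem_univ, true_and,
          Submodule.span_zero_singleton, Submodule.mem_bot]
        constructor
        · intro hi
          by_cases hi0 : e i = 0
          · exact Or.inl hi0
          · obtain ⟨c, hc⟩ := Submodule.mem_span_singleton.1 hi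
            have hc0 : c ≠ 0 := by
              rintro rfl
              exact hi0 (by rw [← hc, zero_smul])
            right
            rw [← hc, Submodule.span_singleton_smul_eq (IsUnit.mk0 c hc0)]
        · rintro (hi | hi)
          · rw [hi]
            exact zero_mem _
          · rw [← hi]
            exact Submodule.mem_span_singleton_self _
      · rw [Finset.disjoint_filter]
        intro i _ hi hi'
        rw [Submodule.span_zero_singleton, Submodule.mem_bot] at hi
        rw [hi, Submodule.span_zero_singleton] at hi'
        exact hL0 (Submodule.span_singleton_eq_bot.1 hi'.symm)
    rw [key f, key g, h0] at hL
    exact Nat.add_left_cancel hL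

/-- MacWilliams' extension theorem, in terms of the coordinate functionals. -/
theorem exists_perm_units_of_card_zeros_eq {n : ℕ} (f g : Fin n → Module.Dual F V)
    (h : ∀ x, Nat.card {i // f i x = 0} = Nat.card {i // g i x = 0}) :
    ∃ (σ : Equiv.Perm (Fin n)) (d : Fin n → Fˣ), ∀ i, g (σ i) = d (σ i) • f i := by
  classical
  have h' : ∀ x, (Finset.univ.filter fun i => f i x = 0).card =
      (Finset.univ.filter fun i => g i x = 0).card := fun x => by
    simpa [Nat.card_eq_fintype_card, Fintype.card_subtype] using h x
  have hfib : ∀ S : Submodule F (Module.Dual F V),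
      Nonempty ({i // Submodule.span F {f i} = S} ≃ {i // Submodule.span F {g i} = S}) := by
    intro S
    refine ⟨Fintype.equivOfCardEq ?_⟩
    rw [Fintype.card_subtype, Fintype.card_subtype]
    by_cases hS : ∃ L, S = Submodule.span F {L}
    · obtain ⟨L, rfl⟩ := hS
      exact card_span_eq_eq f g h' L
    · rw [Finset.filter_false_of_mem fun i _ hi => hS ⟨_, hi.symm⟩,
        Finset.filter_false_of_mem fun i _ hi => hS ⟨_, hi.symm⟩]
  let σ : Equiv.Perm (Fin n) := Equiv.ofFiberEquiv fun S => (hfib S).some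
  have hσ : ∀ i, Submodule.span F {g (σ i)} = Submodule.span F {f i} :=
    fun i => Equiv.ofFiberEquiv_map (fun S => (hfib S).some) i
  choose d hd using fun i => Submodule.span_singleton_eq_span_singleton.1 (hσ i).symm
  refine ⟨σ, fun j => d (σ.symm j), fun i => ?_⟩
  simp only [Equiv.symm_apply_apply, hd i]

end MacWilliams

theorem natCard_zeros_add_hammingNorm {F : Type*} [Field F] [DecidableEq F] {n : ℕ}
    (v : Fin n → F) : Nat.card {i // v i = 0} + hammingNorm v = n := by
  rw [Nat.card_eq_fintype_card, Fintype.card_subtype, hammingNorm]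
  simpa using Finset.card_filter_add_card_filter_not (s := Finset.univ) (fun i => v i = 0)

theorem natDegree_le_rowDeg {F : Type*} [Field F] {k n : ℕ}
    (H : Matrix (Fin k) (Fin n) (Polynomial F)) (i : Fin k) (j : Fin n) :
    (H i j).natDegree ≤ rowDeg H i :=
  Finset.le_sup (f := fun j => (H i j).natDegree) (Finset.mem_univ j)

theorem coeff_eq_mul_of_outputFunctional_eq {F : Type*} [Field F] {k n : ℕ} (ν : Fin k → ℕ)
    {H H' : Matrix (Fin k) (Fin n) (Polynomial F)} (hH : ∀ i j, (H i j).natDegree ≤ ν i)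
    (hH' : ∀ i j, (H' i j).natDegree ≤ ν i) {j j' : Fin n} {c : F}
    (h : outputFunctional ν H' j' = c • outputFunctional ν H j) (i : Fin k) :
    H' i j' = H i j * C c := by
  ext m
  rw [coeff_mul_C]
  by_cases hm : ν i < m
  · rw [coeff_eq_zero_of_natDegree_lt ((hH i j).trans_lt hm),
      coeff_eq_zero_of_natDegree_lt ((hH' i j').trans_lt hm), zero_mul]
  · cases m with
    | zero =>
      have := LinearMap.congr_fun h (0, Pi.single i 1)
      rw [LinearMap.smul_apply, outputFunctional_apply, outputFunctional_apply] at this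
      simpa [Pi.single_apply, mul_comm] using this
    | succ m =>
      have := LinearMap.congr_fun h (Pi.single ⟨i, ⟨m, by omega⟩⟩ 1, 0)
      rw [LinearMap.smul_apply, outputFunctional_apply, outputFunctional_apply] at this
      simpa [Pi.single_apply, mul_comm] using this

end CodingLemmas

/-- Strongly isometric basic reduced encoders sharing the same weight adjacency
matrix (with respect to the same basis of the state space) are monomially
equivalent. -/
theorem stmt13 {F : Type*} [Field F] [Fintype F] [DecidableEq F] {k n δ : ℕ}
    (G Gbar : Matrix (Fin k) (Fin n) (Polynomial F))
    (hG : IsBasic G) (hGred : IsRowReduced G)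
    (hGbar : IsBasic Gbar) (hGbarred : IsRowReduced Gbar)
    (hdG : (∑ i, rowDeg G i) = δ) (hdGbar : (∑ i, rowDeg Gbar i) = δ)
    (hwt : ∀ u : Fin k → Polynomial F, wtP (u ᵥ* G) = wtP (u ᵥ* Gbar))
    (hdeg : ∀ u : Fin k → Polynomial F, u ≠ 0 → degP (u ᵥ* G) = degP (u ᵥ* Gbar))
    (hWAM : ∀ (X Y : Fin δ → F) (w : ℕ), WAMfin G hdG X Y w = WAMfin Gbar hdGbar X Y w) :
    ∃ M : Matrix (Fin n) (Fin n) F, IsMonomialMatrix M ∧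
      Gbar = G * M.map (fun a => Polynomial.C a) := by
  have hrow : rowDeg Gbar = rowDeg G := by
    funext i
    have := hdeg (Pi.single i 1) (by simp)
    simp only [single_one_vecMul] at this
    exact this.symm
  obtain ⟨ν, hν⟩ : ∃ ν, rowDeg G = ν := ⟨_, rfl⟩
  have hνbar : rowDeg Gbar = ν := hrow.trans hν
  have hδ : ∑ i, ν i = δ := hν ▸ hdG
  have hdegG : ∀ i j, (G i j).natDegree ≤ ν i := fun i j => hν ▸ natDegree_le_rowDeg G i j
  have hdegGbar : ∀ i j, (Gbar i j).natDegree ≤ ν i :=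
    fun i j => hνbar ▸ natDegree_le_rowDeg Gbar i j
  have hN : ∀ i, ν i ≤ ∑ i, ν i :=
    fun i => Finset.single_le_sum (fun _ _ => Nat.zero_le _) (Finset.mem_univ i)
  have hout : ∀ x, hammingNorm (fun j => outputFunctional ν G j x) =
      hammingNorm (fun j => outputFunctional ν Gbar j x) := by
    classical
    rintro ⟨X, u⟩
    obtain ⟨X', hX'⟩ := (stateEnc_injective ν hδ).surjective_comp_right X
    obtain ⟨Y', hY'⟩ :=
      (stateEnc_injective ν hδ).surjective_comp_right (X ᵥ* ccfA ν + u ᵥ* ccfB ν)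
    replace hX' : (fun p => X' (stateEnc ν hδ p)) = X := hX'
    replace hY' : (fun p => Y' (stateEnc ν hδ p)) = X ᵥ* ccfA ν + u ᵥ* ccfB ν := hY'
    have hcount := fun w => hWAM X' Y' w
    simp only [WAMfin_eq_ncard G hdG ν hδ hν, WAMfin_eq_ncard Gbar hdGbar ν hδ hνbar,
      hX', hY'] at hcount
    have hsum := sum_hammingNorm_eq_of_ncard_eq
      (fun u' : Fin k → F => X ᵥ* ccfA ν + u' ᵥ* ccfB ν = X ᵥ* ccfA ν + u ᵥ* ccfB ν)
      (fun u' j => outputFunctional ν G j (X, u'))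
      (fun u' j => outputFunctional ν Gbar j (X, u')) hcount
    have hdiff : ∀ u' : Fin k → F,
        X ᵥ* ccfA ν + u' ᵥ* ccfB ν = X ᵥ* ccfA ν + u ᵥ* ccfB ν →
        hammingNorm (fun j => outputFunctional ν G j (X, u)) +
          hammingNorm (fun j => outputFunctional ν Gbar j (X, u')) =
        hammingNorm (fun j => outputFunctional ν Gbar j (X, u)) +
          hammingNorm (fun j => outputFunctional ν G j (X, u')) := by
      intro u' hu'
      have hfree := eq_of_vecMul_ccfB_eq ν (add_left_cancel hu')
      have h1 := wtP_reachInput_add ν hN G hdegG X u u' hfree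
      have h2 := wtP_reachInput_add ν hN Gbar hdegGbar X u u' hfree
      rw [← hwt, ← hwt] at h2
      omega
    set S := Finset.univ.filter fun u' : Fin k → F =>
      X ᵥ* ccfA ν + u' ᵥ* ccfB ν = X ᵥ* ccfA ν + u ᵥ* ccfB ν with hS
    have hu : u ∈ S := by simp [hS]
    have htot := Finset.sum_congr (rfl : S = S)
      fun u' hu' => hdiff u' (Finset.mem_filter.1 hu').2
    rw [Finset.sum_add_distrib, Finset.sum_add_distrib, hsum, Finset.sum_const,
      Finset.sum_const, smul_eq_mul, smul_eq_mul] at htot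
    exact Nat.eq_of_mul_eq_mul_left (Finset.card_pos.2 ⟨u, hu⟩) (Nat.add_right_cancel htot)
  obtain ⟨σ, d, hσ⟩ := exists_perm_units_of_card_zeros_eq
    (outputFunctional ν G) (outputFunctional ν Gbar) fun x => by
      have h1 := natCard_zeros_add_hammingNorm fun j => outputFunctional ν G j x
      have h2 := natCard_zeros_add_hammingNorm fun j => outputFunctional ν Gbar j x
      have h3 := hout x
      omega
  refine ⟨Matrix.of fun i j => if σ i = j then (d j : F) else 0, ⟨σ, d, fun _ _ => rfl⟩, ?_⟩
  ext1 i j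
  obtain ⟨j, rfl⟩ := σ.surjective j
  rw [coeff_eq_mul_of_outputFunctional_eq ν hdegG hdegGbar (hσ j) i, mul_apply,
    Finset.sum_eq_single j]
  · simp
  · intro b _ hb
    simp [hb]
  · simp
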